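/- Let M₅ be the Turing machine with states {A,B,C,D,E,F,H} and symbols {0,1} whose transition table is: δ(A,0)=(1,R,B), δ(A,1)=(0,L,D); δ(B,0)=(1,R,C), δ(B,1)=(0,R,F); δ(C,0)=(1,L,C), δ(C,1)=(1,L,A); δ(D,0)=(0,L,E), δ(D,1)=(1,R,H); δ(E,0)=(1,L,A), δ(E,1)=(0,R,B); δ(F,0)=(0,R,C), δ(F,1)=(0,R,E). Let C(k,n) = ^ω0 1 0^n 1 (C1) 1^{3k} 0^ω. Then M₅ started in configuration C(9,1) halts, and the number of steps T until it reaches a configuration in state H satisfies T > 10^(10^(10^(10^(10^3520)))). -/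

import Mathlib

open Turing

inductive TSt where | A | B | C | D | E | F | H
deriving DecidableEq

inductive Gam where | s0 | s1
deriving DecidableEq

instance : Inhabited Gam := ⟨Gam.s0⟩

abbrev Cfg := TSt × Tape Gam

/-- The transition table of the machine (values from the halting state `H` are never used). -/
def delta : TSt → Gam → Gam × Dir × TSt
  | .A, .s0 => (.s1, Dir.right, .B)
  | .A, .s1 => (.s0, Dir.left, .D)
  | .B, .s0 => (.s1, Dir.right, .C)
  | .B, .s1 => (.s0, Dir.right, .F)
  | .C, .s0 => (.s1, Dir.left, .C)
  | .C, .s1 => (.s1, Dir.left, .A)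
  | .D, .s0 => (.s0, Dir.left, .E)
  | .D, .s1 => (.s1, Dir.right, .H)
  | .E, .s0 => (.s1, Dir.left, .A)
  | .E, .s1 => (.s0, Dir.right, .B)
  | .F, .s0 => (.s0, Dir.right, .C)
  | .F, .s1 => (.s0, Dir.right, .E)
  | .H, a => (a, Dir.right, .H)

/-- One computation step; `none` if the current state is the halting state `H`. -/
def step (c : Cfg) : Option Cfg :=
  if c.1 = TSt.H then none
  else
    let t := delta c.1 c.2.head
    some (t.2.2, (c.2.write t.1).move t.2.1)

/-- `reaches t c₁ c₂` : iterating `step` exactly `t` times starting from `c₁` yields `c₂`. -/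
def reaches (t : ℕ) (c₁ c₂ : Cfg) : Prop :=
  (fun c => Option.bind c step)^[t] (some c₁) = some c₂

/-- The configuration `^ω0 x (q a) y 0^ω` : state `q`, head reading `a`, the word `x`
written immediately to the left of the head (in order), `y` immediately to the right,
blank elsewhere. -/
def mkCfg (x : List Gam) (q : TSt) (a : Gam) (y : List Gam) : Cfg :=
  (q, ⟨a, ListBlank.mk x.reverse, ListBlank.mk y⟩)

/-- `C(k,n) = ^ω0 1 0^n 1 (C1) 1^{3k} 0^ω`. -/
def Cfg5 (k n : ℕ) : Cfg :=
  mkCfg ([.s1] ++ List.replicate n .s0 ++ [.s1]) .C .s1 (List.replicate (3*k) .s1)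

/-- The word `0^n`. -/
abbrev zeros (n : ℕ) : List Gam := List.replicate n .s0

/-- The word `1^n`. -/
abbrev ones (n : ℕ) : List Gam := List.replicate n .s1

/-- The configuration in state `q` reading `a`, where `l` and `r` are the words to the left and to
the right of the head, both listed starting from the cell next to the head. -/
def conf (q : TSt) (l : List Gam) (a : Gam) (r : List Gam) : Cfg :=
  (q, ⟨a, ListBlank.mk l, ListBlank.mk r⟩)

/-- The configuration obtained by the transition `δ` when `l` and `r` are the words to the left and
to the right of the head. -/
@[simp]
def transition : Gam × Dir × TSt → List Gam → List Gam → Cfg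
  | (b, Dir.left, q), l, r => conf q l.tail l.headI (b :: r)
  | (b, Dir.right, q), l, r => conf q (b :: l) r.headI r.tail

theorem step_conf {q : TSt} (hq : q ≠ .H) (l : List Gam) (a : Gam) (r : List Gam) :
    step (conf q l a r) = some (transition (delta q a) l r) := by
  cases q <;> cases a <;> first | rfl | exact absurd rfl hq

@[simp]
theorem reaches_succ_conf {q : TSt} (hq : q ≠ .H) (t : ℕ) (l : List Gam) (a : Gam) (r : List Gam)
    (d : Cfg) :
    reaches (t + 1) (conf q l a r) d ↔ reaches t (transition (delta q a) l r) d := by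
  rw [reaches, Function.iterate_succ_apply, Option.bind_some, step_conf hq, reaches]

@[simp]
theorem reaches_zero (c : Cfg) : reaches 0 c c := rfl

@[simp]
theorem default_gam : (default : Gam) = .s0 := rfl

/-- `c` evolves to `d` in at least `b` steps. -/
def Run (b : ℕ) (c d : Cfg) : Prop := ∃ t, b ≤ t ∧ reaches t c d

theorem Run.of_reaches {t : ℕ} {c d : Cfg} (h : reaches t c d) : Run t c d := ⟨t, le_rfl, h⟩

theorem Run.refl (c : Cfg) : Run 0 c c := .of_reaches (reaches_zero c)

theorem Run.mono {a b : ℕ} {c d : Cfg} (hab : a ≤ b) (h : Run b c d) : Run a c d :=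
  let ⟨t, ht, h⟩ := h
  ⟨t, hab.trans ht, h⟩

theorem Run.trans {a b : ℕ} {c d e : Cfg} (h₁ : Run a c d) (h₂ : Run b d e) :
    Run (a + b) c e := by
  obtain ⟨s, hs, h₁⟩ := h₁
  obtain ⟨t, ht, h₂⟩ := h₂
  refine ⟨t + s, by omega, ?_⟩
  unfold reaches at *
  rw [Function.iterate_add_apply, h₁, h₂]

theorem replicate_append_cons (n : ℕ) (a : Gam) (l : List Gam) :
    List.replicate n a ++ a :: l = List.replicate (n + 1) a ++ l := by
  rw [List.replicate_succ', List.append_assoc, List.singleton_append]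

/-- In state `C` the head fills a block of zeros with ones while moving left. -/
theorem run_fill (a : Gam) (L : List Gam) (i : ℕ) (r : List Gam) :
    Run 0 (conf .C (zeros i ++ a :: L) .s0 r) (conf .C L a (ones (i + 1) ++ r)) := by
  induction i generalizing r with
  | zero => exact (Run.of_reaches (t := 1) (by simp [delta, List.replicate_succ])).mono (by omega)
  | succ i ih =>
    have h : Run 1 (conf .C (zeros (i + 1) ++ a :: L) .s0 r)
        (conf .C (zeros i ++ a :: L) .s0 (.s1 :: r)) :=
      .of_reaches (by simp [delta, List.replicate_succ])
    have h' := h.trans (ih (.s1 :: r))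
    rw [replicate_append_cons] at h'
    exact h'.mono (by omega)

/-- In the states `B`, `F`, `E` the head erases ones in groups of three while moving right. -/
theorem run_erase (L R : List Gam) (j : ℕ) :
    Run 0 (conf .B L .s1 (ones (3 * j) ++ R)) (conf .B (zeros (3 * j) ++ L) .s1 R) := by
  induction j generalizing L with
  | zero => exact Run.refl _
  | succ j ih =>
    have h : Run 3 (conf .B L .s1 (ones (3 * (j + 1)) ++ R))
        (conf .B (.s0 :: .s0 :: .s0 :: L) .s1 (ones (3 * j) ++ R)) :=
      .of_reaches (by simp [delta, List.replicate_succ, Nat.mul_add])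
    have h' := h.trans (ih (.s0 :: .s0 :: .s0 :: L))
    rw [replicate_append_cons, replicate_append_cons, replicate_append_cons] at h'
    exact h'.mono (by omega)

/-- One sweep consumes a zero to the left of the head and adds three ones to its right. -/
theorem run_sweep (L : List Gam) (j : ℕ) :
    Run 1 (conf .C (.s0 :: L) .s1 (ones (3 * j))) (conf .C L .s1 (ones (3 * (j + 1)))) := by
  have h₁ : Run 2 (conf .C (.s0 :: L) .s1 (ones (3 * j)))
      (conf .B (.s1 :: L) .s1 (ones (3 * j))) := .of_reaches (by simp [delta])
  have h₂ := run_erase (.s1 :: L) [] j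
  rw [List.append_nil] at h₂
  have h₃ : Run 2 (conf .B (zeros (3 * j) ++ .s1 :: L) .s1 [])
      (conf .C (zeros (3 * j + 2) ++ .s1 :: L) .s0 []) :=
    .of_reaches (by simp [delta, List.replicate_succ])
  have h₄ := run_fill .s1 L (3 * j + 2) []
  rw [List.append_nil] at h₄
  exact (((h₁.trans h₂).trans h₃).trans h₄).mono (by omega)

theorem run_sweeps (L : List Gam) (i j : ℕ) :
    Run i (conf .C (zeros i ++ L) .s1 (ones (3 * j))) (conf .C L .s1 (ones (3 * (j + i)))) := by
  induction i generalizing j with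
  | zero => exact Run.refl _
  | succ i ih =>
    have h := (run_sweep (zeros i ++ L) j).trans (ih (j + 1))
    rw [show j + 1 + i = j + (i + 1) by omega] at h
    exact h.mono (by omega)

theorem Cfg5_eq_conf (k n : ℕ) :
    Cfg5 k n = conf .C (.s1 :: (zeros n ++ [.s1])) .s1 (ones (3 * k)) := by
  simp [Cfg5, mkCfg, conf]

theorem run_Cfg5_add_four (k n : ℕ) :
    Run (3 * k + 5) (Cfg5 k (n + 4)) (Cfg5 (3 * k + 5) n) := by
  rw [Cfg5_eq_conf, Cfg5_eq_conf]
  have h₁ : Run 12 (conf .C (.s1 :: (zeros (n + 4) ++ [.s1])) .s1 (ones (3 * k)))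
      (conf .B (.s1 :: (zeros n ++ [.s1])) .s1 (ones (3 * k + 4))) :=
    .of_reaches (by simp [delta, List.replicate_succ])
  have h₂ := run_erase (.s1 :: (zeros n ++ [.s1])) (ones 4) k
  rw [List.replicate_append_replicate] at h₂
  have h₃ : Run 12 (conf .B (zeros (3 * k) ++ .s1 :: (zeros n ++ [.s1])) .s1 (ones 4))
      (conf .C (zeros (3 * k + 4) ++ .s1 :: (zeros n ++ [.s1])) .s1 (ones (3 * 1))) :=
    .of_reaches (by simp [delta, List.replicate_succ])
  have h₄ := run_sweeps (.s1 :: (zeros n ++ [.s1])) (3 * k + 4) 1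
  rw [show 1 + (3 * k + 4) = 3 * k + 5 by omega] at h₄
  exact (((h₁.trans h₂).trans h₃).trans h₄).mono (by omega)

theorem run_erase_to_Cfg5 (j : ℕ) :
    Run 0 (conf .B [.s1] .s1 (ones (3 * j + 2))) (Cfg5 2 (3 * j + 2)) := by
  rw [Cfg5_eq_conf]
  have h₁ := run_erase [.s1] (ones 2) j
  rw [List.replicate_append_replicate] at h₁
  have h₂ : Run 16 (conf .B (zeros (3 * j) ++ [.s1]) .s1 (ones 2))
      (conf .C (.s0 :: .s1 :: (zeros (3 * j + 2) ++ [.s1])) .s1 (ones (3 * 1))) :=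
    .of_reaches (by simp [delta, List.replicate_succ])
  exact ((h₁.trans h₂).trans (run_sweep _ 1)).mono (by omega)

theorem run_Cfg5_one (k : ℕ) : Run 0 (Cfg5 k 1) (Cfg5 2 (3 * k + 2)) := by
  rw [Cfg5_eq_conf]
  have h : Run 8 (conf .C (.s1 :: (zeros 1 ++ [.s1])) .s1 (ones (3 * k)))
      (conf .B [.s1] .s1 (ones (3 * k + 2))) := .of_reaches (by simp [delta, List.replicate_succ])
  exact (h.trans (run_erase_to_Cfg5 k)).mono (by omega)

theorem run_Cfg5_three (k : ℕ) : Run 0 (Cfg5 k 3) (Cfg5 2 (3 * k + 8)) := by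
  rw [Cfg5_eq_conf]
  have h : Run 22 (conf .C (.s1 :: (zeros 3 ++ [.s1])) .s1 (ones (3 * k)))
      (conf .B [.s1] .s1 (ones (3 * (k + 2) + 2))) :=
    .of_reaches (by simp [delta, List.replicate_succ, Nat.mul_add])
  exact (h.trans (run_erase_to_Cfg5 (k + 2))).mono (by omega)

theorem run_Cfg5_zero (k : ℕ) : ∃ c : Cfg, Run 0 (Cfg5 k 0) c ∧ c.1 = TSt.H := by
  rw [Cfg5_eq_conf]
  exact ⟨conf .H [.s1] .s0 (ones (3 * k + 1)),
    (Run.of_reaches (t := 3) (by simp [delta, List.replicate_succ])).mono (by omega), rfl⟩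

theorem run_Cfg5_add_four_mul (r m k : ℕ) :
    ∃ K, 2 * K + 5 = (2 * k + 5) * 3 ^ m ∧ Run (K - k) (Cfg5 k (4 * m + r)) (Cfg5 K r) := by
  induction m generalizing k with
  | zero => exact ⟨k, by simp, by simpa using Run.refl _⟩
  | succ m ih =>
    obtain ⟨K, hK, h⟩ := ih (3 * k + 5)
    refine ⟨K, by rw [hK]; ring, ?_⟩
    have h₁ := run_Cfg5_add_four k (4 * m + r)
    rw [show 4 * m + r + 4 = 4 * (m + 1) + r by omega] at h₁
    exact (h₁.trans h).mono (by omega)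

theorem run_Cfg5_of_mod_four_eq_one {N : ℕ} (hN : N % 4 = 1) :
    ∃ N', 2 * N' + 11 = 3 ^ (N / 4 + 3) ∧ Run 0 (Cfg5 2 N) (Cfg5 2 N') := by
  obtain ⟨K, hK, h⟩ := run_Cfg5_add_four_mul 1 (N / 4) 2
  rw [show 4 * (N / 4) + 1 = N by omega] at h
  refine ⟨3 * K + 2, ?_, (h.trans (run_Cfg5_one K)).mono (by omega)⟩
  rw [pow_add]
  omega

theorem run_Cfg5_of_mod_four_eq_three {N : ℕ} (hN : N % 4 = 3) :
    ∃ N', 2 * N' = 3 ^ (N / 4 + 3) + 1 ∧ Run 0 (Cfg5 2 N) (Cfg5 2 N') := by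
  obtain ⟨K, hK, h⟩ := run_Cfg5_add_four_mul 3 (N / 4) 2
  rw [show 4 * (N / 4) + 3 = N by omega] at h
  refine ⟨3 * K + 8, ?_, (h.trans (run_Cfg5_three K)).mono (by omega)⟩
  rw [pow_add]
  omega

theorem thousand_mul_ten_pow_le {X : ℕ} (hX : 10 ≤ X) : 1000 * 10 ^ X ≤ 27 ^ X :=
  calc 1000 * 10 ^ X ≤ 2 ^ X * 10 ^ X :=
        Nat.mul_le_mul_right _ ((by norm_num : 1000 ≤ 2 ^ 10).trans
          (Nat.pow_le_pow_right (by norm_num) hX))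
    _ = 20 ^ X := by rw [← mul_pow]; norm_num
    _ ≤ 27 ^ X := Nat.pow_le_pow_left (by norm_num) X

theorem thousand_mul_ten_pow_le_three_pow {X N : ℕ} (hX : 10 ≤ X) (hN : 12 * X ≤ N) :
    1000 * 10 ^ X ≤ 3 ^ (N / 4) :=
  calc 1000 * 10 ^ X ≤ 27 ^ X := thousand_mul_ten_pow_le hX
    _ = 3 ^ (3 * X) := by rw [pow_mul]; norm_num
    _ ≤ 3 ^ (N / 4) := Nat.pow_le_pow_right (by norm_num) (by omega)

theorem twelve_mul_ten_pow_le {X N N' : ℕ} (hX : 10 ≤ X) (hN : 12 * X ≤ N)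
    (hN' : 3 ^ (N / 4 + 3) ≤ 2 * N' + 11) : 12 * 10 ^ X ≤ N' := by
  have h := thousand_mul_ten_pow_le_three_pow hX hN
  have hpos : 0 < 10 ^ X := by positivity
  rw [pow_add] at hN'
  omega

theorem ten_le_ten_pow {X : ℕ} (hX : 10 ≤ X) : 10 ≤ 10 ^ X :=
  Nat.le_self_pow (by omega) 10

theorem three_pow_mod_eight (a : ℕ) : 3 ^ (2 * a + 1) % 8 = 3 := by
  rw [pow_add, pow_mul, Nat.mul_mod, Nat.pow_mod]
  norm_num

theorem three_pow_mod_sixteen (a : ℕ) : 3 ^ (4 * a) % 16 = 1 := by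
  rw [pow_mul, Nat.pow_mod]
  norm_num

theorem three_pow_mod_thirty_two (a : ℕ) : 3 ^ (8 * a + 6) % 32 = 25 := by
  rw [pow_add, pow_mul, Nat.mul_mod, Nat.pow_mod]
  norm_num

theorem exists_halting_run {X N : ℕ} (hX : 10 ≤ X) (hN : 12 * X ≤ N) (hmod : N % 32 = 13) :
    ∃ (b : ℕ) (c : Cfg), Run b (Cfg5 2 N) c ∧ c.1 = TSt.H ∧ 10 ^ 10 ^ 10 ^ 10 ^ X < b := by
  obtain ⟨P, hP, hrunP⟩ := run_Cfg5_of_mod_four_eq_one (N := N) (by omega)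
  have hP_mod : P % 16 = 7 := by
    have h := three_pow_mod_thirty_two (N / 32)
    rw [show 8 * (N / 32) + 6 = N / 4 + 3 by omega] at h
    omega
  have hXP := twelve_mul_ten_pow_le hX hN hP.ge
  obtain ⟨Q, hQ, hrunQ⟩ := run_Cfg5_of_mod_four_eq_three (N := P) (by omega)
  have hQ_mod : Q % 8 = 1 := by
    have h := three_pow_mod_sixteen (P / 16 + 1)
    rw [show 4 * (P / 16 + 1) = P / 4 + 3 by omega] at h
    omega
  have hXQ := twelve_mul_ten_pow_le (N' := Q) (ten_le_ten_pow hX) hXP (by omega)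
  obtain ⟨R, hR, hrunR⟩ := run_Cfg5_of_mod_four_eq_one (N := Q) (by omega)
  have hR_mod : R % 4 = 0 := by
    have h := three_pow_mod_eight (Q / 8 + 1)
    rw [show 2 * (Q / 8 + 1) + 1 = Q / 4 + 3 by omega] at h
    omega
  have hXR := twelve_mul_ten_pow_le (ten_le_ten_pow (ten_le_ten_pow hX)) hXQ hR.ge
  obtain ⟨K, hK, hrunK⟩ := run_Cfg5_add_four_mul 0 (R / 4) 2
  rw [show 4 * (R / 4) + 0 = R by omega] at hrunK
  obtain ⟨c, hrun_halt, hc⟩ := run_Cfg5_zero K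
  refine ⟨_, c, (((hrunP.trans hrunQ).trans hrunR).trans hrunK).trans hrun_halt, hc, ?_⟩
  have h := thousand_mul_ten_pow_le_three_pow
    (ten_le_ten_pow (ten_le_ten_pow (ten_le_ten_pow hX))) hXR
  have hpos : 0 < 10 ^ 10 ^ 10 ^ 10 ^ X := by positivity
  omega

set_option exponentiation.threshold 10000 in
theorem run_Cfg5_nine_one : ∃ N, 2 * N = 3 ^ 7382 + 1 ∧ Run 0 (Cfg5 9 1) (Cfg5 2 N) := by
  obtain ⟨P, hP, hrunP⟩ := run_Cfg5_of_mod_four_eq_one (N := 29) (by norm_num)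
  obtain rfl : P = 29519 := by omega
  obtain ⟨N, hN, hrunN⟩ := run_Cfg5_of_mod_four_eq_three (N := 29519) (by norm_num)
  exact ⟨N, hN, ((run_Cfg5_one 9).trans hrunP).trans hrunN⟩

set_option exponentiation.threshold 10000 in
theorem bounds_of_two_mul_eq {N : ℕ} (hN : 2 * N = 3 ^ 7382 + 1) :
    12 * 10 ^ 3520 ≤ N ∧ N % 32 = 13 := by
  have h_mod : 3 ^ 7382 % 64 = 25 := by norm_num
  have h_le : 24 * 10 ^ 3520 ≤ 3 ^ 7382 := by norm_num
  generalize 3 ^ 7382 = a at *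
  generalize 10 ^ 3520 = b at *
  omega

theorem stmt13 :
    ∃ (T : ℕ) (c : Cfg), reaches T (Cfg5 9 1) c ∧ c.1 = TSt.H ∧
      T > 10^(10^(10^(10^(10^3520)))) := by
  obtain ⟨N, hN, hrun⟩ := run_Cfg5_nine_one
  obtain ⟨h_le, h_mod⟩ := bounds_of_two_mul_eq hN
  obtain ⟨b, c, hrun', hc, hb⟩ := exists_halting_run (ten_le_ten_pow (by norm_num)) h_le h_mod
  obtain ⟨T, hT, hreach⟩ := hrun.trans hrun'
  exact ⟨T, c, hreach, hc, hb.trans_le ((Nat.le_add_left b 0).trans hT)⟩
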